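/- (q-binomial theorem, terminating form) Let n be a nonnegative integer, let q be a nonzero complex number with (q;q)_n ≠ 0, and let z be a complex number. Then ∑_{j=0}^{n} ((q^{-n};q)_j / (q;q)_j) · z^j = (z q^{-n};q)_n. -/

import Mathlib

/-- The $q$-shifted factorial $(a;q)_m = \prod_{k=0}^{m-1}(1 - a q^k)$. -/
noncomputable def qPoch (q a : ℂ) (m : ℕ) : ℂ := ∏ k ∈ Finset.range m, (1 - a * q ^ k)

lemma qPoch_zero (q a : ℂ) : qPoch q a 0 = 1 := by simp [qPoch]

lemma qPoch_succ (q a : ℂ) (m : ℕ) : qPoch q a (m + 1) = qPoch q a m * (1 - a * q ^ m) :=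
  Finset.prod_range_succ _ _

lemma qPoch_succ' (q a : ℂ) (m : ℕ) : qPoch q a (m + 1) = (1 - a) * qPoch q (a * q) m := by
  simp only [qPoch, Finset.prod_range_succ', pow_zero, mul_one]
  rw [mul_comm]
  congr 1
  exact Finset.prod_congr rfl fun k _ => by ring

lemma qPoch_ne_zero_of_le {q a : ℂ} {m n : ℕ} (h : qPoch q a n ≠ 0) (hmn : m ≤ n) :
    qPoch q a m ≠ 0 := by
  simp only [qPoch, Finset.prod_ne_zero_iff, Finset.mem_range] at h ⊢
  exact fun k hk => h k (hk.trans_le hmn)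

/-- A Pascal-type recurrence for the coefficients `(b;q)_j / (q;q)_j`. -/
lemma qPoch_div_qPoch_succ (q b : ℂ) (j : ℕ) (h : qPoch q q (j + 1) ≠ 0) :
    qPoch q b (j + 1) / qPoch q q (j + 1) =
      qPoch q (b * q) (j + 1) / qPoch q q (j + 1) - b * (qPoch q (b * q) j / qPoch q q j) := by
  have hj := qPoch_ne_zero_of_le h j.le_succ
  have hlast : 1 - q * q ^ j ≠ 0 := by
    rw [qPoch_succ] at h
    exact right_ne_zero_of_mul h
  rw [qPoch_succ' q b, qPoch_succ q (b * q), qPoch_succ q q]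
  field_simp
  ring

/-- Terminating $q$-binomial theorem:
$\sum_{j=0}^{n} \frac{(q^{-n};q)_j}{(q;q)_j} z^j = (zq^{-n};q)_n$. -/
theorem q_binomial_terminating (n : ℕ) (q z : ℂ) (hq : q ≠ 0) (hqq : qPoch q q n ≠ 0) :
    ∑ j ∈ Finset.range (n + 1),
      qPoch q (q ^ (-(n : ℤ))) j / qPoch q q j * z ^ j
    = qPoch q (z * q ^ (-(n : ℤ))) n := by
  induction n with
  | zero => simp [qPoch_zero]
  | succ n ih =>
    have ih := ih (qPoch_ne_zero_of_le hqq n.le_succ)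
    have hb : q ^ (-((n + 1 : ℕ) : ℤ)) * q = q ^ (-(n : ℤ)) := by
      rw [← zpow_add_one₀ hq]
      congr 1
      push_cast
      ring
    have hvanish : qPoch q (q ^ (-(n : ℤ))) (n + 1) = 0 := by
      rw [qPoch_succ, zpow_neg, zpow_natCast, inv_mul_cancel₀ (pow_ne_zero n hq), sub_self,
        mul_zero]
    generalize q ^ (-((n + 1 : ℕ) : ℤ)) = b at hb ⊢
    rw [← hb] at ih hvanish
    have hshift : ∑ j ∈ Finset.range (n + 1),
        qPoch q (b * q) (j + 1) / qPoch q q (j + 1) * z ^ (j + 1) + 1 =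
        qPoch q (z * (b * q)) n := by
      have h := Finset.sum_range_succ' (fun j => qPoch q (b * q) j / qPoch q q j * z ^ j) (n + 1)
      rw [Finset.sum_range_succ, ih, hvanish] at h
      simpa [qPoch_zero] using h.symm
    have hrec : ∀ j ∈ Finset.range (n + 1),
        qPoch q b (j + 1) / qPoch q q (j + 1) * z ^ (j + 1) =
          qPoch q (b * q) (j + 1) / qPoch q q (j + 1) * z ^ (j + 1) -
            b * z * (qPoch q (b * q) j / qPoch q q j * z ^ j) := by
      intro j hj
      rw [qPoch_div_qPoch_succ q b j (qPoch_ne_zero_of_le hqq (Finset.mem_range.mp hj))]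
      ring
    rw [Finset.sum_range_succ', Finset.sum_congr rfl hrec, Finset.sum_sub_distrib,
      ← Finset.mul_sum, ih, qPoch_succ', mul_assoc z b q]
    simp only [qPoch_zero, pow_zero, div_one, mul_one]
    linear_combination hshift
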